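/- Let n ≥ 1 and 0 < q, θ < ∞. Let u, w be weights on (0,∞) and v a weight on ℝⁿ. Define ṽ(t) := ess sup_{s' ∈ S^{n-1}} v(t s') for t > 0. Suppose the one-dimensional inequality (∫₀^∞ (∫₀^t g(s) ṽ(s) ds)^q u(t) dt)^{1/q} ≤ C' (∫₀^∞ (∫₀^t g(s) ds)^θ w(t) dt)^{1/θ} holds with constant C' for every nonnegative measurable g on (0,∞). Then for every nonnegative measurable f on ℝⁿ, (∫₀^∞ (∫_{B(0,t)} f(s) v(s) ds)^q u(t) dt)^{1/q} ≤ C' (∫₀^∞ (∫_{B(0,t)} f(s) ds)^θ w(t) dt)^{1/θ}. -/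

import Mathlib

open MeasureTheory Set ENNReal

noncomputable section

/-- The set `B(a,b) = {y ∈ ℝⁿ : a < |y| < b}`. -/
def annulus (n : ℕ) (a b : ℝ) : Set (EuclideanSpace ℝ (Fin n)) :=
  {y | a < ‖y‖ ∧ ‖y‖ < b}

theorem aux_annulus (n : ℕ)
    (σ : Measure (Metric.sphere (0 : EuclideanSpace ℝ (Fin n)) 1))
    (hσ : ∀ f : EuclideanSpace ℝ (Fin n) → ℝ≥0∞, Measurable f →
      (∫⁻ x, f x) = ∫⁻ τ in Ioi (0 : ℝ),
        ∫⁻ s', f (τ • (s' : EuclideanSpace ℝ (Fin n))) * ENNReal.ofReal (τ ^ (n - 1)) ∂σ)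
    (F : EuclideanSpace ℝ (Fin n) → ℝ≥0∞) (hF : Measurable F) (t : ℝ) :
    ∫⁻ s in annulus n 0 t, F s = ∫⁻ τ in Ioo (0 : ℝ) t,
      ∫⁻ s', F (τ • (s' : EuclideanSpace ℝ (Fin n))) * ENNReal.ofReal (τ ^ (n - 1)) ∂σ := by
  have hm : MeasurableSet (annulus n 0 t) :=
    (measurableSet_lt measurable_const measurable_norm).inter
      (measurableSet_lt measurable_norm measurable_const)
  rw [← lintegral_indicator hm, hσ _ (hF.indicator hm), ← Ioi_inter_Iio, inter_comm,
    ← setLIntegral_indicator measurableSet_Iio]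
  refine setLIntegral_congr_fun measurableSet_Ioi fun τ hτ => ?_
  have hτ' : (0 : ℝ) < τ := hτ
  have hn : ∀ s' : Metric.sphere (0 : EuclideanSpace ℝ (Fin n)) 1,
      (τ • (s' : EuclideanSpace ℝ (Fin n)) ∈ annulus n 0 t ↔ τ < t) := by
    intro s'
    have : ‖(s' : EuclideanSpace ℝ (Fin n))‖ = 1 := by simp
    have h2 : ‖τ • (s' : EuclideanSpace ℝ (Fin n))‖ = τ := by
      rw [norm_smul, this, mul_one, Real.norm_of_nonneg hτ'.le]
    simp only [annulus, mem_setOf_eq, h2, hτ', true_and]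
  by_cases h : τ < t
  · simp [Set.indicator, hn, h]
  · simp [Set.indicator, hn, h]

theorem aux_finite (n : ℕ)
    (σ : Measure (Metric.sphere (0 : EuclideanSpace ℝ (Fin n)) 1))
    (hσ : ∀ f : EuclideanSpace ℝ (Fin n) → ℝ≥0∞, Measurable f →
      (∫⁻ x, f x) = ∫⁻ τ in Ioi (0 : ℝ),
        ∫⁻ s', f (τ • (s' : EuclideanSpace ℝ (Fin n))) * ENNReal.ofReal (τ ^ (n - 1)) ∂σ) :
    IsFiniteMeasure σ := by
  have h := aux_annulus n σ hσ (fun _ => 1) measurable_const 1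
  simp only [lintegral_const, one_mul, Measure.restrict_apply_univ] at h
  have hlt : volume (annulus n 0 1) < ⊤ := by
    refine (measure_mono ?_).trans_lt
      (measure_ball_lt_top (x := (0 : EuclideanSpace ℝ (Fin n))) (r := 1))
    intro x hx
    simpa using hx.2
  rw [h] at hlt
  have hae := ae_lt_top (μ := volume.restrict (Ioo (0 : ℝ) 1))
    (f := fun τ => ENNReal.ofReal (τ ^ (n - 1)) * σ univ) (by fun_prop) hlt.ne
  have : (ae (volume.restrict (Ioo (0 : ℝ) 1))).NeBot := by
    rw [ae_neBot, Ne, Measure.restrict_eq_zero]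
    simp
  obtain ⟨τ, h1, h2⟩ := (hae.and (ae_restrict_mem measurableSet_Ioo)).exists
  refine ⟨?_⟩
  have hp : ENNReal.ofReal (τ ^ (n - 1)) ≠ 0 := by
    simpa using pow_pos h2.1 _
  by_contra hc
  rw [not_lt, top_le_iff] at hc
  rw [hc, ENNReal.mul_top hp] at h1
  exact lt_irrefl _ h1

theorem statement4 (n : ℕ) (hn : 1 ≤ n) (q θ : ℝ) (hq : 0 < q) (hθ : 0 < θ)
    (u w : ℝ → ℝ≥0∞) (v : EuclideanSpace ℝ (Fin n) → ℝ≥0∞)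
    (hum : Measurable u)
    (hu : ∀ᵐ t ∂(volume.restrict (Ioi (0 : ℝ))), 0 < u t ∧ u t < ⊤)
    (hwm : Measurable w)
    (hw : ∀ᵐ t ∂(volume.restrict (Ioi (0 : ℝ))), 0 < w t ∧ w t < ⊤)
    (hvm : Measurable v)
    (hv : ∀ᵐ x ∂(volume : Measure (EuclideanSpace ℝ (Fin n))), 0 < v x ∧ v x < ⊤)
    (σ : Measure (Metric.sphere (0 : EuclideanSpace ℝ (Fin n)) 1))
    (hσ : ∀ f : EuclideanSpace ℝ (Fin n) → ℝ≥0∞, Measurable f →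
      (∫⁻ x, f x) = ∫⁻ τ in Ioi (0 : ℝ),
        ∫⁻ s', f (τ • (s' : EuclideanSpace ℝ (Fin n))) * ENNReal.ofReal (τ ^ (n - 1)) ∂σ)
    (C' : ℝ≥0∞)
    (hC' : ∀ g : ℝ → ℝ≥0∞, Measurable g →
      (∫⁻ t in Ioi (0 : ℝ), (∫⁻ s in Ioo (0 : ℝ) t, g s *
          essSup (fun s' : Metric.sphere (0 : EuclideanSpace ℝ (Fin n)) 1 =>
            v (s • (s' : EuclideanSpace ℝ (Fin n)))) σ) ^ q * u t) ^ (1 / q) ≤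
        C' * (∫⁻ t in Ioi (0 : ℝ), (∫⁻ s in Ioo (0 : ℝ) t, g s) ^ θ * w t) ^ (1 / θ)) :
    ∀ f : EuclideanSpace ℝ (Fin n) → ℝ≥0∞, Measurable f →
      (∫⁻ t in Ioi (0 : ℝ), (∫⁻ s in annulus n 0 t, f s * v s) ^ q * u t) ^ (1 / q) ≤
        C' * (∫⁻ t in Ioi (0 : ℝ), (∫⁻ s in annulus n 0 t, f s) ^ θ * w t) ^ (1 / θ) := by
  intro f hf
  have := aux_finite n σ hσ
  set g : ℝ → ℝ≥0∞ := fun τ =>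
    ∫⁻ s', f (τ • (s' : EuclideanSpace ℝ (Fin n))) * ENNReal.ofReal (τ ^ (n - 1)) ∂σ with hg
  have hgm : Measurable g := by
    refine Measurable.lintegral_prod_right' (ν := σ) (f := fun p :
      ℝ × Metric.sphere (0 : EuclideanSpace ℝ (Fin n)) 1 =>
        f (p.1 • (p.2 : EuclideanSpace ℝ (Fin n))) * ENNReal.ofReal (p.1 ^ (n - 1))) ?_
    fun_prop
  have key := hC' g hgm
  have hR : ∀ t, ∫⁻ s in annulus n 0 t, f s = ∫⁻ s in Ioo (0 : ℝ) t, g s :=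
    fun t => aux_annulus n σ hσ f hf t
  simp only [hR]
  refine le_trans ?_ key
  gcongr with t
  rw [aux_annulus n σ hσ (fun s => f s * v s) (hf.mul hvm) t]
  refine lintegral_mono fun τ => ?_
  have hgm2 : Measurable fun s' : Metric.sphere (0 : EuclideanSpace ℝ (Fin n)) 1 =>
      f (τ • (s' : EuclideanSpace ℝ (Fin n))) * ENNReal.ofReal (τ ^ (n - 1)) := by fun_prop
  simp only [hg]
  rw [← lintegral_mul_const _ hgm2]
  refine lintegral_mono_ae ?_
  filter_upwards [ENNReal.ae_le_essSup (μ := σ)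
    (fun s' : Metric.sphere (0 : EuclideanSpace ℝ (Fin n)) 1 =>
      v (τ • (s' : EuclideanSpace ℝ (Fin n))))] with s' hs'
  rw [mul_right_comm]
  gcongr
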